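/- Let (π,U,H) be a covariant representation of (A,δ) possessing property (*). Then for every complex number z with |z| = 1 there exists a *-automorphism α_z of C*(π(A),U) such that α_z(π(a)) = π(a) for all a ∈ A and α_z(U) = zU; moreover, for each k ∈ ℤ the closure of B_k in C*(π(A),U) equals the spectral subspace {a ∈ C*(π(A),U) : α_z(a) = z^k a for all z with |z|=1}; in particular the closure of B_0 is the fixed point algebra of the action z ↦ α_z. -/

import Mathlib

open Filter Topology
open scoped NNReal

noncomputable section

variable {A : Type*} [CStarAlgebra A]

/-- The underlying set of the matrix algebra `M(A)`: matrices over `A` with finitely many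
nonzero entries satisfying the entry condition `a_{ij} ∈ δ^i(1)·A·δ^j(1)`. -/
def MatMem (δ : A →⋆ₙₐ[ℂ] A) (a : ℕ → ℕ → A) : Prop :=
  ({p : ℕ × ℕ | a p.1 p.2 ≠ 0}).Finite ∧
    ∀ i j : ℕ, (⇑δ)^[i] 1 * a i j * (⇑δ)^[j] 1 = a i j

/-- The shift `Λ : Λ(a)_{ij} = δ(a_{i-1,j-1})` for `i, j ≥ 1`, and `0` otherwise. -/
def lam (δ : A →⋆ₙₐ[ℂ] A) (a : ℕ → ℕ → A) : ℕ → ℕ → A :=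
  fun i j => if i = 0 ∨ j = 0 then 0 else δ (a (i - 1) (j - 1))

/-- Ordinary (finitely supported) matrix multiplication. -/
def matMul (a b : ℕ → ℕ → A) : ℕ → ℕ → A := fun i k => ∑ᶠ j : ℕ, a i j * b j k

/-- The convolution multiplication `a ⋆ b = a·Σ_{j≥0} Λ^j(b) + Σ_{j≥1} Λ^j(a)·b`. -/
def conv (δ : A →⋆ₙₐ[ℂ] A) (a b : ℕ → ℕ → A) : ℕ → ℕ → A :=
  fun i k => (∑ᶠ j : ℕ, matMul a ((lam δ)^[j] b) i k) +
    ∑ᶠ j : ℕ, matMul ((lam δ)^[j + 1] a) b i k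

/-- The involution `(a*)_{mn} = (a_{nm})*`. -/
def mstar (a : ℕ → ℕ → A) : ℕ → ℕ → A := fun i j => star (a j i)

/-- The embedding of `A` into `M(A)` at the `(0,0)` entry. -/
def embed (a : A) : ℕ → ℕ → A := fun i j => if i = 0 ∧ j = 0 then a else 0

/-- The matrix `u`, having `δ(1)` at the `(0,1)` entry and zeros elsewhere. -/
def umat (δ : A →⋆ₙₐ[ℂ] A) : ℕ → ℕ → A := fun i j => if i = 0 ∧ j = 1 then δ 1 else 0

/-- `⋆`-powers of a matrix (`mpow δ x 0` is the matrix unit `embed 1`). -/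
def mpow (δ : A →⋆ₙₐ[ℂ] A) (x : ℕ → ℕ → A) : ℕ → ℕ → ℕ → A
  | 0 => embed 1
  | n + 1 => conv δ (mpow δ x n) x

/-- A matrix is `k`-diagonal if all entries away from the `k`-th diagonal vanish. -/
def IsDiag (k : ℤ) (a : ℕ → ℕ → A) : Prop :=
  ∀ i j : ℕ, a i j ≠ 0 → (j : ℤ) - (i : ℤ) = k

/-- The `n`-th entry `a_n^{(k)}` of the `k`-th diagonal of a matrix. -/
def diagEntry (a : ℕ → ℕ → A) (k : ℤ) (n : ℕ) : A :=
  if 0 ≤ k then a n (n + k.toNat) else a (n + (-k).toNat) n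

/-- `N_k` carries the `k`-th diagonal onto the `0`-th diagonal and deletes the rest. -/
def Nmat (a : ℕ → ℕ → A) (k : ℤ) : ℕ → ℕ → A :=
  fun i j => if i = j then diagEntry a k i else 0

variable {H : Type*} [NormedAddCommGroup H] [InnerProductSpace ℂ H] [CompleteSpace H]

/-- `(π, U, H)` is a covariant representation of `(A, δ)`. -/
def IsCovariantRep (δ : A →⋆ₙₐ[ℂ] A) (π : A →⋆ₐ[ℂ] (H →L[ℂ] H)) (U : H →L[ℂ] H) : Prop :=
  Function.Injective π ∧ U * star U * U = U ∧
    (∀ a : A, U * π a * star U = π (δ a)) ∧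
    (∀ a : A, star U * U * π a = π a * (star U * U))

/-- The map `Ψ_{(π,U)} : M(A) → B(H)`, `a ↦ Σ_{m,n} U^{*m} π(a_{mn}) U^n`. -/
def Psi (π : A →⋆ₐ[ℂ] (H →L[ℂ] H)) (U : H →L[ℂ] H) (a : ℕ → ℕ → A) : H →L[ℂ] H :=
  ∑ᶠ (m : ℕ) (n : ℕ), (star U) ^ m * π (a m n) * U ^ n

/-- Property `(*)` of a covariant representation. -/
def PropertyStar (δ : A →⋆ₙₐ[ℂ] A) (π : A →⋆ₐ[ℂ] (H →L[ℂ] H)) (U : H →L[ℂ] H) : Prop :=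
  ∀ a : ℕ → ℕ → A, MatMem δ a →
    ‖∑ᶠ m : ℕ, (star U) ^ m * π (a m m) * U ^ m‖ ≤ ‖Psi π U a‖

/-- The space `M_k` of `k`-diagonal matrices of `M(A)`. -/
def Mdiag (δ : A →⋆ₙₐ[ℂ] A) (k : ℤ) : Set (ℕ → ℕ → A) :=
  {a | MatMem δ a ∧ IsDiag k a}

section Monomials

variable {B R : Type*} [CStarAlgebra B] [Ring R] [StarRing R] [Algebra ℂ R]

/-- The linear map sending a finitely supported matrix `c` over `B` to
`Σ_{m,n} U^{*m} π(c_{mn}) U^n`. -/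
def monomialSum (π : B →⋆ₐ[ℂ] R) (U : R) : (ℕ × ℕ →₀ B) →ₗ[ℂ] R :=
  Finsupp.lsum ℂ fun p =>
    LinearMap.mulLeft ℂ (star U ^ p.1) ∘ₗ LinearMap.mulRight ℂ (U ^ p.2) ∘ₗ
      (π : B →ₐ[ℂ] R).toLinearMap

theorem monomialSum_single (π : B →⋆ₐ[ℂ] R) (U : R) (p : ℕ × ℕ) (b : B) :
    monomialSum π U (Finsupp.single p b) = star U ^ p.1 * π b * U ^ p.2 := by
  simp [monomialSum, mul_assoc]

theorem monomial_mem_range (π : B →⋆ₐ[ℂ] R) (U : R) (m n : ℕ) (b : B) :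
    star U ^ m * π b * U ^ n ∈ LinearMap.range (monomialSum π U) :=
  ⟨Finsupp.single (m, n) b, monomialSum_single π U (m, n) b⟩

theorem range_monomialSum_le {π : B →⋆ₐ[ℂ] R} {U : R} {S : Submodule ℂ R}
    (h : ∀ m n b, star U ^ m * π b * U ^ n ∈ S) :
    LinearMap.range (monomialSum π U) ≤ S := by
  rintro _ ⟨c, rfl⟩
  induction c using Finsupp.induction_linear with
  | zero => simp
  | add f g hf hg => rw [map_add]; exact add_mem hf hg
  | single p b => rw [monomialSum_single]; exact h _ _ _

theorem monomialSum_mem_adjoin [StarModule ℂ R] (π : B →⋆ₐ[ℂ] R) (U : R) (c : ℕ × ℕ →₀ B) :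
    monomialSum π U c ∈ StarAlgebra.adjoin ℂ (Set.range π ∪ {U}) := by
  have hU : U ∈ StarAlgebra.adjoin ℂ (Set.range π ∪ {U}) :=
    StarAlgebra.subset_adjoin ℂ _ (Or.inr rfl)
  refine range_monomialSum_le (S := Subalgebra.toSubmodule
    (StarAlgebra.adjoin ℂ (Set.range π ∪ {U})).toSubalgebra) (fun m n b => ?_) ⟨c, rfl⟩
  change _ ∈ StarAlgebra.adjoin ℂ (Set.range π ∪ {U})
  exact mul_mem (mul_mem (pow_mem (star_mem hU) m)
    (StarAlgebra.subset_adjoin ℂ _ (Or.inl ⟨b, rfl⟩))) (pow_mem hU n)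

variable {δ : B →⋆ₙₐ[ℂ] B} {π : B →⋆ₐ[ℂ] R} {U : R}

theorem pow_mul_map (hU : U * star U * U = U) (hδ : ∀ b, U * π b * star U = π (δ b))
    (hc : ∀ b, star U * U * π b = π b * (star U * U)) (n : ℕ) (b : B) :
    U ^ n * π b = π (δ^[n] b) * U ^ n := by
  induction n generalizing b with
  | zero => simp
  | succ n ih =>
    have h : U * π b = π (δ b) * U := by
      calc U * π b = U * star U * U * π b := by rw [hU]
        _ = U * (star U * U * π b) := by simp only [mul_assoc]
        _ = U * π b * star U * U := by rw [hc]; simp only [mul_assoc]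
        _ = π (δ b) * U := by rw [hδ]
    rw [pow_succ, mul_assoc, h, ← mul_assoc, ih, mul_assoc, Function.iterate_succ_apply]

theorem map_mul_star_pow [StarModule ℂ R] (hU : U * star U * U = U)
    (hδ : ∀ b, U * π b * star U = π (δ b))
    (hc : ∀ b, star U * U * π b = π b * (star U * U)) (n : ℕ) (b : B) :
    π b * star U ^ n = star U ^ n * π (δ^[n] b) := by
  have h := congrArg star (pow_mul_map hU hδ hc n (star b))
  have hs : star (δ^[n] (star b)) = δ^[n] b := by
    rw [(Function.Commute.iterate_left (f := δ) (g := star)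
      (fun x => map_star δ x) n) b, star_star]
  simpa [← map_star, hs] using h

theorem pow_mul_star_pow (hδ : ∀ b, U * π b * star U = π (δ b)) (n : ℕ) :
    U ^ n * star U ^ n = π (δ^[n] 1) := by
  induction n with
  | zero => simp
  | succ n ih =>
    rw [pow_succ', pow_succ, Function.iterate_succ_apply', ← hδ, ← ih]
    simp only [mul_assoc]

theorem map_iterate_one_mul_pow (hU : U * star U * U = U)
    (hδ : ∀ b, U * π b * star U = π (δ b))
    (hc : ∀ b, star U * U * π b = π b * (star U * U)) (n : ℕ) :
    π (δ^[n] 1) * U ^ n = U ^ n := by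
  simpa using (pow_mul_map hU hδ hc n 1).symm

theorem star_pow_mul_map_iterate_one [StarModule ℂ R] (hU : U * star U * U = U)
    (hδ : ∀ b, U * π b * star U = π (δ b))
    (hc : ∀ b, star U * U * π b = π b * (star U * U)) (n : ℕ) :
    star U ^ n * π (δ^[n] 1) = star U ^ n := by
  simpa using (map_mul_star_pow hU hδ hc n 1).symm

theorem monomial_cut [StarModule ℂ R] (hU : U * star U * U = U)
    (hδ : ∀ b, U * π b * star U = π (δ b))
    (hc : ∀ b, star U * U * π b = π b * (star U * U)) (m n : ℕ) (b : B) :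
    star U ^ m * π (δ^[m] 1 * b * δ^[n] 1) * U ^ n = star U ^ m * π b * U ^ n := by
  calc star U ^ m * π (δ^[m] 1 * b * δ^[n] 1) * U ^ n
      = star U ^ m * π (δ^[m] 1) * π b * (π (δ^[n] 1) * U ^ n) := by
        simp only [map_mul, mul_assoc]
    _ = star U ^ m * π b * U ^ n := by
        rw [star_pow_mul_map_iterate_one hU hδ hc, map_iterate_one_mul_pow hU hδ hc]

theorem monomial_mul_monomial [StarModule ℂ R] (hU : U * star U * U = U)
    (hδ : ∀ b, U * π b * star U = π (δ b))
    (hc : ∀ b, star U * U * π b = π b * (star U * U)) (m n p q : ℕ) (b c : B) :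
    (star U ^ m * π b * U ^ n) * (star U ^ p * π c * U ^ q) ∈
      LinearMap.range (monomialSum π U) := by
  rcases le_total p n with h | h
  · obtain ⟨k, rfl⟩ := Nat.exists_eq_add_of_le' h
    convert monomial_mem_range π U m (k + q) (b * δ^[k] (δ^[p] 1 * c)) using 1
    calc (star U ^ m * π b * U ^ (k + p)) * (star U ^ p * π c * U ^ q)
        = star U ^ m * π b * (U ^ k * ((U ^ p * star U ^ p) * π c)) * U ^ q := by
          rw [pow_add]; simp only [mul_assoc]
      _ = _ := by
          rw [pow_mul_star_pow hδ, ← map_mul, pow_mul_map hU hδ hc, pow_add U k q, map_mul π b]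
          simp only [mul_assoc]
  · obtain ⟨k, rfl⟩ := Nat.exists_eq_add_of_le h
    convert monomial_mem_range π U (m + k) q (δ^[k] (b * δ^[n] 1) * c) using 1
    calc (star U ^ m * π b * U ^ n) * (star U ^ (n + k) * π c * U ^ q)
        = star U ^ m * ((π b * (U ^ n * star U ^ n)) * star U ^ k) * (π c * U ^ q) := by
          rw [pow_add]; simp only [mul_assoc]
      _ = _ := by
          rw [pow_mul_star_pow hδ, ← map_mul, map_mul_star_pow hU hδ hc, pow_add (star U) m k,
            map_mul π _ c]
          simp only [mul_assoc]

theorem adjoin_le_range_monomialSum [StarModule ℂ R] (hU : U * star U * U = U)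
    (hδ : ∀ b, U * π b * star U = π (δ b))
    (hc : ∀ b, star U * U * π b = π b * (star U * U)) {x : R}
    (hx : x ∈ StarAlgebra.adjoin ℂ (Set.range π ∪ {U})) :
    x ∈ LinearMap.range (monomialSum π U) := by
  induction hx using StarAlgebra.adjoin_induction with
  | mem x h =>
    rcases h with ⟨b, rfl⟩ | rfl
    · simpa using monomial_mem_range π U 0 0 b
    · simpa using monomial_mem_range π x 0 1 1
  | algebraMap r => simpa only [pow_zero, one_mul, mul_one, AlgHomClass.commutes] using
      monomial_mem_range π U 0 0 (algebraMap ℂ B r)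
  | add x y _ _ hx hy => exact add_mem hx hy
  | mul x y _ _ hx hy =>
    have h₁ (m n : ℕ) (b : B) : LinearMap.range (monomialSum π U) ≤
        (LinearMap.range (monomialSum π U)).comap
          (LinearMap.mulLeft ℂ (star U ^ m * π b * U ^ n)) :=
      range_monomialSum_le fun p q c => monomial_mul_monomial hU hδ hc m n p q b c
    have h₂ : LinearMap.range (monomialSum π U) ≤
        (LinearMap.range (monomialSum π U)).comap (LinearMap.mulRight ℂ y) :=
      range_monomialSum_le fun m n b => h₁ m n b hy
    exact h₂ hx
  | star x hx' hx =>
    clear hx'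
    obtain ⟨c, rfl⟩ := hx
    induction c using Finsupp.induction_linear with
    | zero => simp
    | add f g hf hg => rw [map_add, star_add]; exact add_mem hf hg
    | single p b =>
      rw [monomialSum_single]
      convert monomial_mem_range π U p.2 p.1 (star b) using 1
      simp [mul_assoc, ← map_star]

end Monomials

open MeasureTheory

section CircleMean

variable [MeasurableSpace Circle] [BorelSpace Circle]

/-- The normalized Haar measure of the circle. -/
abbrev circleMeasure : Measure Circle :=
  Measure.haarMeasure (⊤ : TopologicalSpace.PositiveCompacts Circle)

instance : IsProbabilityMeasure circleMeasure :=
  ⟨Measure.haarMeasure_self⟩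

theorem integral_circle_zpow_eq_zero {k : ℤ} (hk : k ≠ 0) :
    ∫ z : Circle, ((z ^ k : Circle) : ℂ) ∂circleMeasure = 0 := by
  obtain ⟨w, hw⟩ : ∃ w : Circle, ((w ^ k : Circle) : ℂ) ≠ 1 := by
    refine ⟨Circle.exp (Real.pi / k), ?_⟩
    rw [← Circle.exp_zsmul]
    have : (k : ℤ) • (Real.pi / k) = Real.pi := by
      rw [zsmul_eq_mul, mul_div_cancel₀]; exact_mod_cast hk
    rw [this, Circle.coe_exp, Complex.exp_pi_mul_I]
    norm_num
  have h := integral_mul_left_eq_self (μ := circleMeasure)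
    (fun z : Circle => ((z ^ k : Circle) : ℂ)) w
  simp only [mul_zpow, Circle.coe_mul, integral_const_mul] at h
  have h' : (((w ^ k : Circle) : ℂ) - 1) *
      ∫ z : Circle, ((z ^ k : Circle) : ℂ) ∂circleMeasure = 0 := by
    rw [sub_mul, h, one_mul, sub_self]
  exact (mul_eq_zero.mp h').resolve_left (sub_ne_zero.mpr hw)

variable {E : Type*} [NormedAddCommGroup E] [NormedSpace ℂ E]

theorem integrable_circle_zpow_smul (k : ℤ) (f : C(Circle, E)) :
    Integrable (fun z : Circle => ((z ^ k : Circle) : ℂ) • f z) circleMeasure := by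
  refine Continuous.integrable_of_hasCompactSupport ?_ (HasCompactSupport.of_compactSpace _)
  exact (continuous_zpow k).smul f.continuous

/-- The `k`-th Fourier coefficient of a continuous function on the circle. -/
def circleCoeff (k : ℤ) : C(Circle, E) →L[ℂ] E :=
  LinearMap.mkContinuous
    { toFun := fun f => ∫ z : Circle, ((z ^ (-k) : Circle) : ℂ) • f z ∂circleMeasure
      map_add' := fun f g => by
        simp only [ContinuousMap.add_apply, smul_add]
        exact integral_add (integrable_circle_zpow_smul _ f) (integrable_circle_zpow_smul _ g)
      map_smul' := fun c f => by
        simp only [ContinuousMap.smul_apply, smul_comm _ c, integral_smul, RingHom.id_apply] }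
    1 fun f => by
      refine (norm_integral_le_of_norm_le_const (C := 1 * ‖f‖) (.of_forall fun z => ?_)).trans ?_
      · rw [norm_smul, Circle.norm_coe]
        gcongr
        exact f.norm_coe_le_norm z
      · simp

theorem circleCoeff_apply (k : ℤ) (f : C(Circle, E)) :
    circleCoeff k f = ∫ z : Circle, ((z ^ (-k) : Circle) : ℂ) • f z ∂circleMeasure :=
  rfl

theorem circleCoeff_of_eq_zpow_smul [CompleteSpace E] {k l : ℤ} {x : E} {f : C(Circle, E)}
    (hf : ∀ z : Circle, f z = ((z ^ l : Circle) : ℂ) • x) :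
    circleCoeff k f = if l = k then x else 0 := by
  simp only [circleCoeff_apply, hf, smul_smul, ← Circle.coe_mul, ← zpow_add, integral_smul_const]
  split_ifs with h
  · simp [h]
  · rw [integral_circle_zpow_eq_zero (by omega), zero_smul]

variable {H : Type*} [NormedAddCommGroup H] [InnerProductSpace ℂ H] [CompleteSpace H]

theorem eq_zero_of_circleCoeff_star_mul_self {f : C(Circle, H →L[ℂ] H)}
    (hf : circleCoeff 0 (star f * f) = 0) : f = 0 := by
  have hcont (v : H) : Continuous fun z => ‖f z v‖ ^ 2 := by fun_prop
  have hint : Integrable (fun z => (star f * f) z) circleMeasure := by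
    simpa using integrable_circle_zpow_smul 0 (star f * f)
  have hzero : ∫ z, (star f * f) z ∂circleMeasure = 0 := by
    simpa [circleCoeff_apply] using hf
  have key (v : H) : (fun z => ‖f z v‖ ^ 2) = fun _ => 0 := by
    rw [← (hcont v).ae_eq_iff_eq circleMeasure
      continuous_const]
    have hnorm (z : Circle) : ((innerSL ℂ v).comp (ContinuousLinearMap.apply ℂ H v))
        ((star f * f) z) = ((‖f z v‖ ^ 2 : ℝ) : ℂ) := by
      simp [ContinuousLinearMap.star_eq_adjoint, ContinuousLinearMap.adjoint_inner_right,
        inner_self_eq_norm_sq_to_K]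
    have h := ContinuousLinearMap.integral_comp_comm
      ((innerSL ℂ v).comp (ContinuousLinearMap.apply ℂ H v)) hint
    simp only [hnorm, hzero, map_zero, integral_complex_ofReal, Complex.ofReal_eq_zero] at h
    refine (integral_eq_zero_iff_of_nonneg (fun z => by positivity) ?_).mp h
    exact (hcont v).integrable_of_hasCompactSupport
      (HasCompactSupport.of_compactSpace _)
  ext z v
  have := congrFun (key v) z
  simpa using this

end CircleMean

section Matrices

variable {B : Type*} [CStarAlgebra B] {H : Type*} [NormedAddCommGroup H] [InnerProductSpace ℂ H]
  [CompleteSpace H] {δ : B →⋆ₙₐ[ℂ] B} {π : B →⋆ₐ[ℂ] (H →L[ℂ] H)} {U : H →L[ℂ] H}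

/-- The matrix of `M(B)` with entries `δ^i(1) c_{ij} δ^j(1)`. -/
def cutMatrix (δ : B →⋆ₙₐ[ℂ] B) (c : ℕ × ℕ →₀ B) : ℕ → ℕ → B :=
  fun i j => (⇑δ)^[i] 1 * c (i, j) * (⇑δ)^[j] 1

theorem iterate_one_mul_self (δ : B →⋆ₙₐ[ℂ] B) (n : ℕ) : δ^[n] 1 * δ^[n] 1 = δ^[n] 1 := by
  rw [← iterate_map_mul, one_mul]

theorem matMem_cutMatrix (δ : B →⋆ₙₐ[ℂ] B) (c : ℕ × ℕ →₀ B) : MatMem δ (cutMatrix δ c) := by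
  refine ⟨c.support.finite_toSet.subset fun p hp => ?_, fun i j => ?_⟩
  · rw [Finset.mem_coe, Finsupp.mem_support_iff]
    intro h
    exact hp (by simp [cutMatrix, h])
  · calc δ^[i] 1 * (δ^[i] 1 * c (i, j) * δ^[j] 1) * δ^[j] 1
        = (δ^[i] 1 * δ^[i] 1) * c (i, j) * (δ^[j] 1 * δ^[j] 1) := by simp only [mul_assoc]
      _ = _ := by rw [iterate_one_mul_self, iterate_one_mul_self]; rfl

/-- The part of a finitely supported matrix lying on the `k`-th diagonal. -/
def diagPart (k : ℤ) (c : ℕ × ℕ →₀ B) : ℕ × ℕ →₀ B :=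
  c.filter fun p => (p.2 : ℤ) - p.1 = k

@[simp]
theorem diagPart_zero (k : ℤ) : diagPart k (0 : ℕ × ℕ →₀ B) = 0 :=
  Finsupp.filter_zero _

@[simp]
theorem diagPart_add (k : ℤ) (c d : ℕ × ℕ →₀ B) :
    diagPart k (c + d) = diagPart k c + diagPart k d :=
  Finsupp.filter_add

theorem diagPart_single (k : ℤ) (p : ℕ × ℕ) (b : B) :
    diagPart k (Finsupp.single p b) =
      if (p.2 : ℤ) - p.1 = k then Finsupp.single p b else 0 := by
  split_ifs with h
  · exact Finsupp.filter_single_of_pos _ h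
  · exact Finsupp.filter_single_of_neg _ h

theorem cutMatrix_diagPart_mem_Mdiag (δ : B →⋆ₙₐ[ℂ] B) (k : ℤ) (c : ℕ × ℕ →₀ B) :
    cutMatrix δ (diagPart k c) ∈ Mdiag δ k := by
  refine ⟨matMem_cutMatrix δ _, fun i j hij => ?_⟩
  by_contra h
  exact hij (by simp [cutMatrix, diagPart, h])

theorem Psi_eq_monomialSum {a : ℕ → ℕ → B} {c : ℕ × ℕ →₀ B}
    (h : ∀ i j, star U ^ i * π (a i j) * U ^ j = star U ^ i * π (c (i, j)) * U ^ j) :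
    Psi π U a = monomialSum π U c := by
  have hsupp : (Function.support fun p : ℕ × ℕ => star U ^ p.1 * π (c p) * U ^ p.2) ⊆
      c.support := by
    intro p hp
    rw [Finset.mem_coe, Finsupp.mem_support_iff]
    intro h0
    exact hp (by simp [h0])
  simp only [Psi, h]
  rw [← finsum_curry (fun p : ℕ × ℕ => star U ^ p.1 * π (c p) * U ^ p.2)
    (c.support.finite_toSet.subset hsupp), finsum_eq_sum_of_support_subset _ hsupp]
  simp [monomialSum, Finsupp.sum, mul_assoc]

theorem Psi_cutMatrix (hrep : IsCovariantRep δ π U) (c : ℕ × ℕ →₀ B) :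
    Psi π U (cutMatrix δ c) = monomialSum π U c :=
  Psi_eq_monomialSum fun i j => monomial_cut hrep.2.1 hrep.2.2.1 hrep.2.2.2 i j _

theorem norm_monomialSum_diagPart_le (hrep : IsCovariantRep δ π U) (hstar : PropertyStar δ π U)
    (c : ℕ × ℕ →₀ B) :
    ‖monomialSum π U (diagPart 0 c)‖ ≤ ‖monomialSum π U c‖ := by
  have h := hstar _ (matMem_cutMatrix δ c)
  rw [Psi_cutMatrix hrep] at h
  convert h using 2
  rw [← Psi_cutMatrix hrep, Psi]
  refine finsum_congr fun m => ?_
  rw [finsum_eq_single _ m]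
  · simp [cutMatrix, diagPart]
  · intro n hn
    have : ¬ ((n : ℤ) - m = 0) := by omega
    simp [cutMatrix, diagPart, this]

theorem exists_finsupp_of_mem_Mdiag {k : ℤ} {a : ℕ → ℕ → B} (ha : a ∈ Mdiag δ k) :
    ∃ c : ℕ × ℕ →₀ B, diagPart k c = c ∧ Psi π U a = monomialSum π U c := by
  refine ⟨Finsupp.ofSupportFinite (fun p => a p.1 p.2) ha.1.1, ?_,
    Psi_eq_monomialSum fun i j => rfl⟩
  exact (Finsupp.filter_eq_self_iff _ _).2 fun p hp => ha.2 p.1 p.2 hp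

end Matrices

section Circle

variable {B : Type*} [CStarAlgebra B] {H : Type*} [NormedAddCommGroup H] [InnerProductSpace ℂ H]
  [CompleteSpace H] {δ : B →⋆ₙₐ[ℂ] B}

/-- Evaluation of operator-valued functions at a point of the circle. -/
def evalStarHom (z : Circle) : C(Circle, H →L[ℂ] H) →⋆ₐ[ℂ] (H →L[ℂ] H) where
  toFun f := f z
  map_one' := rfl
  map_mul' _ _ := rfl
  map_zero' := rfl
  map_add' _ _ := rfl
  commutes' _ := rfl
  map_star' _ := rfl

/-- The constant functions with values in the image of `π`. -/
def constRep (π : B →⋆ₐ[ℂ] (H →L[ℂ] H)) : B →⋆ₐ[ℂ] C(Circle, H →L[ℂ] H) where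
  toFun b := ContinuousMap.const _ (π b)
  map_one' := by ext; simp
  map_mul' x y := by ext; simp
  map_zero' := by ext; simp
  map_add' x y := by ext; simp
  commutes' r := by ext; simp [Algebra.algebraMap_eq_smul_one]
  map_star' x := by ext; simp [map_star]

/-- The function `z ↦ zU` on the circle. -/
def rotU (U : H →L[ℂ] H) : C(Circle, H →L[ℂ] H) where
  toFun z := (z : ℂ) • U
  continuous_toFun := continuous_id.smul (continuous_const (y := U))

variable {π : B →⋆ₐ[ℂ] (H →L[ℂ] H)} {U : H →L[ℂ] H}

@[simp]
theorem constRep_apply (b : B) (z : Circle) : constRep π b z = π b := rfl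

omit [CompleteSpace H] in
@[simp]
theorem rotU_apply (z : Circle) : rotU U z = (z : ℂ) • U := rfl

theorem star_coe_circle_mul (z : Circle) : star (z : ℂ) * z = 1 := by
  simp [← Circle.coe_inv_eq_conj]

theorem coe_circle_mul_star (z : Circle) : (z : ℂ) * star (z : ℂ) = 1 := by
  rw [mul_comm, star_coe_circle_mul]

theorem rotU_mul_star_mul (hrep : IsCovariantRep δ π U) :
    rotU U * star (rotU U) * rotU U = rotU U := by
  refine ContinuousMap.ext fun z => ?_
  simp only [ContinuousMap.mul_apply, ContinuousMap.star_apply, rotU_apply, star_smul,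
    smul_mul_smul_comm, coe_circle_mul_star, one_mul, hrep.2.1]

theorem rotU_mul_constRep_mul_star (hrep : IsCovariantRep δ π U) (b : B) :
    rotU U * constRep π b * star (rotU U) = constRep π (δ b) := by
  refine ContinuousMap.ext fun z => ?_
  simp only [ContinuousMap.mul_apply, ContinuousMap.star_apply, rotU_apply, star_smul,
    constRep_apply, smul_mul_assoc, mul_smul_comm, smul_smul, star_coe_circle_mul, one_smul,
    hrep.2.2.1]

theorem star_rotU_mul_comm (hrep : IsCovariantRep δ π U) (b : B) :
    star (rotU U) * rotU U * constRep π b = constRep π b * (star (rotU U) * rotU U) := by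
  refine ContinuousMap.ext fun z => ?_
  simp only [ContinuousMap.mul_apply, ContinuousMap.star_apply, rotU_apply, star_smul,
    constRep_apply, smul_mul_smul_comm, star_coe_circle_mul, one_smul, hrep.2.2.2]

theorem monomial_circle_apply (p : ℕ × ℕ) (b : B) (z : Circle) :
    monomialSum (constRep π) (rotU U) (Finsupp.single p b) z =
      ((z ^ ((p.2 : ℤ) - p.1) : Circle) : ℂ) • monomialSum π U (Finsupp.single p b) := by
  simp only [monomialSum_single, ContinuousMap.mul_apply, ContinuousMap.pow_apply,
    ContinuousMap.star_apply, rotU_apply, star_smul, constRep_apply, smul_pow, smul_mul_assoc,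
    mul_smul_comm, smul_smul]
  congr 1
  rw [zpow_sub, zpow_natCast, zpow_natCast, mul_comm, Circle.coe_mul, Circle.coe_inv_eq_conj]
  simp [mul_comm]

theorem monomialSum_circle_one (c : ℕ × ℕ →₀ B) :
    monomialSum (constRep π) (rotU U) c 1 = monomialSum π U c := by
  induction c using Finsupp.induction_linear with
  | zero => simp
  | add f g hf hg => simp [hf, hg]
  | single p b => simp [monomial_circle_apply]

theorem monomialSum_circle_diagPart (k : ℤ) (c : ℕ × ℕ →₀ B) (z : Circle) :
    monomialSum (constRep π) (rotU U) (diagPart k c) z =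
      ((z ^ k : Circle) : ℂ) • monomialSum π U (diagPart k c) := by
  induction c using Finsupp.induction_linear with
  | zero => simp
  | add f g hf hg => simp only [diagPart_add, map_add, ContinuousMap.add_apply, hf, hg, smul_add]
  | single p b =>
    rw [diagPart_single]
    split_ifs with h
    · rw [monomial_circle_apply, h]
    · simp

theorem circleCoeff_monomialSum [MeasurableSpace Circle] [BorelSpace Circle] (k : ℤ)
    (c : ℕ × ℕ →₀ B) :
    circleCoeff k (monomialSum (constRep π) (rotU U) c) = monomialSum π U (diagPart k c) := by
  induction c using Finsupp.induction_linear with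
  | zero => simp
  | add f g hf hg => simp only [diagPart_add, map_add, hf, hg]
  | single p b =>
    rw [circleCoeff_of_eq_zpow_smul (monomial_circle_apply p b), diagPart_single, apply_ite
      (monomialSum π U), map_zero]

/-- The `C⋆`-algebra of functions on the circle generated by the constants `π(b)` and `z ↦ zU`. -/
abbrev circleAlg (π : B →⋆ₐ[ℂ] (H →L[ℂ] H)) (U : H →L[ℂ] H) :
    StarSubalgebra ℂ C(Circle, H →L[ℂ] H) :=
  (StarAlgebra.adjoin ℂ (Set.range (constRep π) ∪ {rotU U})).topologicalClosure

theorem circleAlg_le_closure_range (hrep : IsCovariantRep δ π U) :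
    (circleAlg π U : Set C(Circle, H →L[ℂ] H)) ⊆
      closure (Set.range (monomialSum (constRep π) (rotU U))) :=
  closure_mono fun _ hx => adjoin_le_range_monomialSum (rotU_mul_star_mul hrep)
    (rotU_mul_constRep_mul_star hrep) (star_rotU_mul_comm hrep) hx

theorem monomialSum_mem_circleAlg (c : ℕ × ℕ →₀ B) :
    monomialSum (constRep π) (rotU U) c ∈ circleAlg π U :=
  StarSubalgebra.le_topologicalClosure _ (monomialSum_mem_adjoin _ _ c)

theorem constRep_mem_circleAlg (b : B) : constRep π b ∈ circleAlg π U :=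
  StarSubalgebra.le_topologicalClosure _ (StarAlgebra.subset_adjoin ℂ _ (Or.inl ⟨b, rfl⟩))

theorem rotU_mem_circleAlg : rotU U ∈ circleAlg π U :=
  StarSubalgebra.le_topologicalClosure _ (StarAlgebra.subset_adjoin ℂ _ (Or.inr rfl))

/-- The function `z ↦ z^k x` on the circle. -/
def zpowSMul (k : ℤ) (x : H →L[ℂ] H) : C(Circle, H →L[ℂ] H) where
  toFun z := z ^ k • x
  continuous_toFun := (continuous_zpow k).smul continuous_const

omit [CompleteSpace H] in
@[simp]
theorem zpowSMul_apply (k : ℤ) (x : H →L[ℂ] H) (z : Circle) :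
    zpowSMul k x z = ((z ^ k : Circle) : ℂ) • x := rfl

omit [CompleteSpace H] in
theorem continuous_zpowSMul (k : ℤ) :
    Continuous (zpowSMul k : (H →L[ℂ] H) → C(Circle, H →L[ℂ] H)) := by
  refine ContinuousMap.continuous_of_continuous_uncurry _ ?_
  exact ((continuous_zpow k).comp continuous_snd).smul continuous_fst

theorem zpowSMul_mem_circleAlg {k : ℤ} {x : H →L[ℂ] H}
    (hx : x ∈ closure (Psi π U '' Mdiag δ k)) : zpowSMul k x ∈ circleAlg π U := by
  have hclosed : IsClosed (circleAlg π U : Set C(Circle, H →L[ℂ] H)) :=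
    StarSubalgebra.isClosed_topologicalClosure _
  refine closure_minimal ?_ (hclosed.preimage (continuous_zpowSMul k)) hx
  rintro _ ⟨a, ha, rfl⟩
  obtain ⟨c, hc, hac⟩ := exists_finsupp_of_mem_Mdiag (π := π) (U := U) ha
  have : zpowSMul k (Psi π U a) = monomialSum (constRep π) (rotU U) c := by
    refine ContinuousMap.ext fun z => ?_
    rw [zpowSMul_apply, hac, ← hc, monomialSum_circle_diagPart]
  rw [Set.mem_preimage, this]
  exact monomialSum_mem_circleAlg c

section Faithful

variable [MeasurableSpace Circle] [BorelSpace Circle]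

theorem norm_circleCoeff_zero_le (hrep : IsCovariantRep δ π U) (hstar : PropertyStar δ π U)
    {f : C(Circle, H →L[ℂ] H)} (hf : f ∈ circleAlg π U) : ‖circleCoeff 0 f‖ ≤ ‖f 1‖ := by
  have hclosed : IsClosed {f : C(Circle, H →L[ℂ] H) | ‖circleCoeff 0 f‖ ≤ ‖f 1‖} :=
    isClosed_le (by fun_prop) (by fun_prop)
  refine closure_minimal ?_ hclosed (circleAlg_le_closure_range hrep hf)
  rintro _ ⟨c, rfl⟩
  rw [Set.mem_ofPred_eq, circleCoeff_monomialSum, monomialSum_circle_one]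
  exact norm_monomialSum_diagPart_le hrep hstar c

theorem eq_zero_of_apply_one_eq_zero (hrep : IsCovariantRep δ π U) (hstar : PropertyStar δ π U)
    {f : C(Circle, H →L[ℂ] H)} (hf : f ∈ circleAlg π U) (h1 : f 1 = 0) : f = 0 := by
  refine eq_zero_of_circleCoeff_star_mul_self (norm_le_zero_iff.mp ?_)
  simpa [h1] using norm_circleCoeff_zero_le hrep hstar (mul_mem (star_mem hf) hf)

end Faithful

theorem apply_mem_of_mem_circleAlg (z : Circle) {f : C(Circle, H →L[ℂ] H)}
    (hf : f ∈ circleAlg π U) :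
    f z ∈ (StarAlgebra.adjoin ℂ (Set.range π ∪ {U})).topologicalClosure := by
  have hle : StarAlgebra.adjoin ℂ (Set.range (constRep π) ∪ {rotU U}) ≤
      (StarAlgebra.adjoin ℂ (Set.range π ∪ {U})).comap
        (evalStarHom z) := by
    refine StarAlgebra.adjoin_le ?_
    rintro _ (⟨b, rfl⟩ | rfl)
    · exact StarAlgebra.subset_adjoin ℂ _ (Or.inl ⟨b, rfl⟩)
    · change (z : ℂ) • U ∈ StarAlgebra.adjoin ℂ (Set.range π ∪ {U})
      exact SMulMemClass.smul_mem (z : ℂ) (StarAlgebra.subset_adjoin ℂ _ (Or.inr rfl))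
  exact map_mem_closure (f := fun f : C(Circle, H →L[ℂ] H) => f z) (by fun_prop) hf
    fun x hx => hle hx

theorem comp_mulRight_mem_circleAlg (w : Circle) {f : C(Circle, H →L[ℂ] H)}
    (hf : f ∈ circleAlg π U) : f.comp (ContinuousMap.mulRight w) ∈ circleAlg π U := by
  have hle : StarAlgebra.adjoin ℂ (Set.range (constRep π) ∪ {rotU U}) ≤
      (StarAlgebra.adjoin ℂ (Set.range (constRep π) ∪ {rotU U})).comap
        (ContinuousMap.compStarAlgHom' ℂ (H →L[ℂ] H) (ContinuousMap.mulRight w)) := by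
    refine StarAlgebra.adjoin_le ?_
    rintro _ (⟨b, rfl⟩ | rfl)
    · exact StarAlgebra.subset_adjoin ℂ _ (Or.inl ⟨b, rfl⟩)
    · have : ContinuousMap.compStarAlgHom' ℂ (H →L[ℂ] H) (ContinuousMap.mulRight w) (rotU U) =
          (w : ℂ) • rotU U := by
        ext z : 1
        simp [smul_smul, mul_comm]
      change ContinuousMap.compStarAlgHom' ℂ (H →L[ℂ] H) (ContinuousMap.mulRight w) (rotU U) ∈
        StarAlgebra.adjoin ℂ (Set.range (constRep π) ∪ {rotU U})
      rw [this]
      exact SMulMemClass.smul_mem (w : ℂ) (StarAlgebra.subset_adjoin ℂ _ (Or.inr rfl))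
  exact map_mem_closure (f := fun f : C(Circle, H →L[ℂ] H) => f.comp (ContinuousMap.mulRight w))
    (ContinuousMap.continuous_precomp _) hf fun x hx => hle hx

theorem exists_mem_circleAlg_apply_one_eq (hrep : IsCovariantRep δ π U)
    (hstar : PropertyStar δ π U) {x : H →L[ℂ] H}
    (hx : x ∈ (StarAlgebra.adjoin ℂ (Set.range π ∪ {U})).topologicalClosure) :
    ∃ f ∈ circleAlg π U, f 1 = x := by
  let _ : MeasurableSpace Circle := borel Circle
  have : BorelSpace Circle := ⟨rfl⟩
  have : IsClosed (circleAlg π U : Set C(Circle, H →L[ℂ] H)) :=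
    StarSubalgebra.isClosed_topologicalClosure _
  let φ : circleAlg π U →⋆ₐ[ℂ] (H →L[ℂ] H) :=
    (evalStarHom (1 : Circle)).comp (circleAlg π U).subtype
  have hφ : Function.Injective φ := fun f g hfg => Subtype.ext <| sub_eq_zero.mp <|
    eq_zero_of_apply_one_eq_zero hrep hstar (sub_mem f.2 g.2) (sub_eq_zero.mpr hfg)
  have hclosed : IsClosed (Set.range φ) :=
    (NonUnitalStarAlgHom.isometry φ hφ).isClosedEmbedding.isClosed_range
  have hle : StarAlgebra.adjoin ℂ (Set.range π ∪ {U}) ≤ φ.range := by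
    refine StarAlgebra.adjoin_le ?_
    rintro _ (⟨b, rfl⟩ | rfl)
    · exact ⟨⟨constRep π b, constRep_mem_circleAlg b⟩, rfl⟩
    · exact ⟨⟨rotU _, rotU_mem_circleAlg⟩, one_smul ℂ _⟩
  obtain ⟨f, hf⟩ := closure_minimal (fun y hy => hle hy) hclosed hx
  exact ⟨f, f.2, hf⟩

end Circle

/-- If `(π,U,H)` possesses property `(*)`, there is a gauge action
`α` of the circle on `C*(π(A),U)` with `α_z(π(a)) = π(a)`, `α_z(U) = zU`, whose
spectral subspaces are the closures of the `B_k`; in particular the closure of `B₀`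
is the fixed-point algebra. -/
theorem gauge_action {A : Type*} [CStarAlgebra A] (δ : A →⋆ₙₐ[ℂ] A)
    {H : Type*} [NormedAddCommGroup H] [InnerProductSpace ℂ H] [CompleteSpace H]
    (π : A →⋆ₐ[ℂ] (H →L[ℂ] H)) (U : H →L[ℂ] H)
    (hrep : IsCovariantRep δ π U) (hstar : PropertyStar δ π U) :
    ∃ α : ℂ → (H →L[ℂ] H) → (H →L[ℂ] H),
      (∀ z : ℂ, ‖z‖ = 1 →
        Set.BijOn (α z)
          ((StarAlgebra.adjoin ℂ (Set.range ⇑π ∪ {U})).topologicalClosure :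
            Set (H →L[ℂ] H))
          ((StarAlgebra.adjoin ℂ (Set.range ⇑π ∪ {U})).topologicalClosure :
            Set (H →L[ℂ] H)) ∧
        (∀ x ∈ ((StarAlgebra.adjoin ℂ (Set.range ⇑π ∪ {U})).topologicalClosure :
            Set (H →L[ℂ] H)),
          ∀ y ∈ ((StarAlgebra.adjoin ℂ (Set.range ⇑π ∪ {U})).topologicalClosure :
            Set (H →L[ℂ] H)),
          α z (x + y) = α z x + α z y ∧ α z (x * y) = α z x * α z y) ∧
        (∀ (w : ℂ),
          ∀ x ∈ ((StarAlgebra.adjoin ℂ (Set.range ⇑π ∪ {U})).topologicalClosure :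
            Set (H →L[ℂ] H)), α z (w • x) = w • α z x) ∧
        (∀ x ∈ ((StarAlgebra.adjoin ℂ (Set.range ⇑π ∪ {U})).topologicalClosure :
            Set (H →L[ℂ] H)), α z (star x) = star (α z x)) ∧
        (∀ a : A, α z (π a) = π a) ∧
        α z U = z • U) ∧
      (∀ k : ℤ,
        closure (Psi π U '' Mdiag δ k) =
          {x : H →L[ℂ] H |
            x ∈ ((StarAlgebra.adjoin ℂ (Set.range ⇑π ∪ {U})).topologicalClosure :
              Set (H →L[ℂ] H)) ∧
            ∀ z : ℂ, ‖z‖ = 1 → α z x = z ^ k • x}) := by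
  let _ : MeasurableSpace Circle := borel Circle
  have : BorelSpace Circle := ⟨rfl⟩
  choose! F hF hF1 using fun x hx => exists_mem_circleAlg_apply_one_eq hrep hstar (x := x) hx
  have huniq {f : C(Circle, H →L[ℂ] H)} (hf : f ∈ circleAlg π U) : F (f 1) = f := by
    have h1 := apply_mem_of_mem_circleAlg 1 hf
    refine sub_eq_zero.mp (eq_zero_of_apply_one_eq_zero hrep hstar (sub_mem (hF _ h1) hf) ?_)
    rw [ContinuousMap.sub_apply, hF1 _ h1, sub_self]
  have hmem {x : H →L[ℂ] H}
      (hx : x ∈ (StarAlgebra.adjoin ℂ (Set.range π ∪ {U})).topologicalClosure) (w : Circle) :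
      F x w ∈ (StarAlgebra.adjoin ℂ (Set.range π ∪ {U})).topologicalClosure :=
    apply_mem_of_mem_circleAlg w (hF x hx)
  have hcomp {x : H →L[ℂ] H}
      (hx : x ∈ (StarAlgebra.adjoin ℂ (Set.range π ∪ {U})).topologicalClosure) (v w : Circle) :
      F (F x w) v = F x (v * w) := by
    have h := huniq (comp_mulRight_mem_circleAlg w (hF x hx))
    simpa using congrArg (· v) h
  refine ⟨fun z x => F x (Circle.exp z.arg), fun z hz => ?_, fun k => ?_⟩
  · obtain ⟨w, rfl⟩ : ∃ w : Circle, (w : ℂ) = z := ⟨⟨z, mem_sphere_zero_iff_norm.2 hz⟩, rfl⟩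
    simp only [Circle.exp_arg]
    refine ⟨?_, fun x hx y hy => ⟨?_, ?_⟩, fun c x hx => ?_, fun x hx => ?_, fun a => ?_, ?_⟩
    · refine Set.InvOn.bijOn (f' := fun x => F x w⁻¹) ⟨fun x hx => ?_, fun x hx => ?_⟩
        (fun x hx => hmem hx w) (fun x hx => hmem hx w⁻¹)
      · simpa [hF1 x hx] using hcomp hx w⁻¹ w
      · simpa [hF1 x hx] using hcomp hx w w⁻¹
    · simpa [hF1 x hx, hF1 y hy] using congrArg (· w) (huniq (add_mem (hF x hx) (hF y hy)))
    · simpa [hF1 x hx, hF1 y hy] using congrArg (· w) (huniq (mul_mem (hF x hx) (hF y hy)))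
    · simpa [hF1 x hx] using congrArg (· w) (huniq (SMulMemClass.smul_mem c (hF x hx)))
    · simpa [hF1 x hx] using congrArg (· w) (huniq (star_mem (hF x hx)))
    · simpa using congrArg (· w) (huniq (constRep_mem_circleAlg (U := U) a))
    · simpa using congrArg (· w) (huniq (rotU_mem_circleAlg (π := π)))
  · apply subset_antisymm
    · intro x hx
      have hf : zpowSMul k x ∈ circleAlg π U := zpowSMul_mem_circleAlg hx
      have hx1 : zpowSMul k x 1 = x := by simp
      refine ⟨hx1 ▸ apply_mem_of_mem_circleAlg 1 hf, fun z hz => ?_⟩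
      obtain ⟨w, rfl⟩ : ∃ w : Circle, (w : ℂ) = z := ⟨⟨z, mem_sphere_zero_iff_norm.2 hz⟩, rfl⟩
      have h := huniq hf
      rw [hx1] at h
      simp [h]
    · rintro x ⟨hx, hxz⟩
      have hcoeff : circleCoeff k (F x) = x := by
        rw [circleCoeff_of_eq_zpow_smul (l := k) (x := x) fun w => ?_, if_pos rfl]
        simpa using hxz w (Circle.norm_coe w)
      rw [← hcoeff]
      refine map_mem_closure (circleCoeff k).continuous (circleAlg_le_closure_range hrep (hF x hx))
        ?_
      rintro _ ⟨c, rfl⟩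
      exact ⟨_, cutMatrix_diagPart_mem_Mdiag δ k c, by
        rw [Psi_cutMatrix hrep, circleCoeff_monomialSum]⟩
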